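/- Let X be a nonempty finite set and Y a finite set with |Y| = d ≥ 2, and let W be a channel from X to Y, i.e. W : X → Y → ℝ with W x y ≥ 0 and ∑ y, W x y = 1 for every x. Let S_max and S_min be respectively the maximum and minimum over x ∈ X of the entropy H(W x) of the output column W x, and set L = (log(d-1))² + 4. Then the Shannon capacity C(W) = sup over probability vectors π on X of I(π, W), where I(π, W) = ∑_{x,y} π x · W x y · log( W x y / (∑_{x'} π x' · W x' y) ) (with 0·log(·) = 0 and terms with vanishing output probability omitted), satisfies C(W) ≥ (S_max - S_min)²/(2L) - (S_max - S_min)³/(3L²). -/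

import Mathlib

open scoped ENNReal BigOperators

noncomputable section

/-- Binary entropy (natural log), with Lean's convention `Real.log 0 = 0`. -/
def binEntropy' (x : ℝ) : ℝ := -(x * Real.log x) - (1 - x) * Real.log (1 - x)

/-- Binary relative entropy, valued in `[0,∞]`. -/
def binRelEntropy (x y : ℝ) : ℝ≥0∞ :=
  if (y = 0 ∧ 0 < x) ∨ (y = 1 ∧ x < 1) then ⊤
  else ENNReal.ofReal (x * Real.log (x / y) + (1 - x) * Real.log ((1 - x) / (1 - y)))

/-- `M(Δ,d)`: infimum of binary relative entropies under the entropy-difference constraint. -/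
def Mfun (Δ : ℝ) (d : ℕ) : ℝ≥0∞ :=
  sInf {m : ℝ≥0∞ | ∃ s r : ℝ, s ∈ Set.Icc (0:ℝ) (((d:ℝ) - 1) / d) ∧
    r ∈ Set.Icc (0:ℝ) (((d:ℝ) - 1) / d) ∧
    binEntropy' s - binEntropy' r + (s - r) * Real.log ((d:ℝ) - 1) = Δ ∧
    m = binRelEntropy s r}

/-- Shannon entropy of a probability vector on `Fin d` (natural log). -/
def shEntropy {d : ℕ} (p : Fin d → ℝ) : ℝ := ∑ i, -(p i * Real.log (p i))

/-- Relative entropy between probability vectors on `Fin d`, valued in `[0,∞]`. -/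
def relEntropy {d : ℕ} (p q : Fin d → ℝ) : ℝ≥0∞ :=
  if ∀ i, q i = 0 → p i = 0
  then ENNReal.ofReal (∑ i, p i * Real.log (p i / q i))
  else ⊤

/-- `N(d) = sup_{0<r<1/2} r(1-r) (log(((1-r)/r)(d-1)))²`. -/
def Nfun (d : ℕ) : ℝ :=
  sSup {v : ℝ | ∃ r : ℝ, 0 < r ∧ r < 1/2 ∧
    v = r * (1 - r) * (Real.log ((1 - r) / r * ((d:ℝ) - 1)))^2}

section

open Real Finset

/-- Variance of the surprisal `-log q` of a probability vector `q` under `q` itself. -/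
def surprisalVar {d : ℕ} (q : Fin d → ℝ) : ℝ :=
  ∑ i, q i * log (q i) ^ 2 - (∑ i, q i * log (q i)) ^ 2

lemma surprisalVar_eq_sum_sq {d : ℕ} {q : Fin d → ℝ} (hq : ∑ i, q i = 1) :
    surprisalVar q = ∑ i, q i * (log (q i) - ∑ j, q j * log (q j)) ^ 2 := by
  set m := ∑ j, q j * log (q j) with hm
  have h : ∀ i, q i * (log (q i) - m) ^ 2
      = q i * log (q i) ^ 2 - 2 * m * (q i * log (q i)) + m ^ 2 * q i := fun i => by ring
  simp only [h, sum_add_distrib, sum_sub_distrib, ← mul_sum, hq, ← hm, surprisalVar]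
  ring

/-- The surprisal variance of a two-level distribution with levels at odds `(1 - r) / r` and
degeneracy ratio `exp c`. -/
lemma mul_add_log_odds_sq_le {r : ℝ} (h0 : 0 < r) (h1 : r < 1) (c : ℝ) :
    r * (1 - r) * (c + log ((1 - r) / r)) ^ 2 ≤ c ^ 2 / 4 + 1 := by
  obtain ⟨w, hw⟩ : ∃ w, log ((1 - r) / r) = 2 * w := ⟨log ((1 - r) / r) / 2, by ring⟩
  have h1' : 0 < 1 - r := by linarith
  have hr : 0 < r * (1 - r) := by positivity
  have hexp : exp w ^ 2 = (1 - r) / r := by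
    rw [← exp_nat_mul, Nat.cast_ofNat, ← hw, exp_log (by positivity)]
  have hcosh : 4 * (r * (1 - r)) * cosh w ^ 2 = 1 := by
    have hne := exp_ne_zero w
    have : cosh w ^ 2 = (exp w ^ 2 + 2 + (exp w ^ 2)⁻¹) / 4 := by
      rw [cosh_eq, exp_neg]; field_simp; ring
    rw [this, hexp]
    field_simp
    ring
  have hw2 : 1 + w ^ 2 ≤ cosh w ^ 2 := by
    rw [cosh_sq']
    have : |w| ≤ |sinh w| := by
      rcases le_total 0 w with h | h
      · rw [abs_of_nonneg h, abs_of_nonneg (sinh_nonneg_iff.2 h)]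
        exact self_le_sinh_iff.2 h
      · rw [abs_of_nonpos h, abs_of_nonpos (sinh_nonpos_iff.2 h)]
        exact neg_le_neg (sinh_le_self_iff.2 h)
    linarith [sq_le_sq.2 this]
  rw [hw]
  have hcauchy : (c + 2 * w) ^ 2 ≤ (c ^ 2 + 4) * (1 + w ^ 2) := by
    nlinarith [sq_nonneg (c * w - 2)]
  calc r * (1 - r) * (c + 2 * w) ^ 2
      ≤ r * (1 - r) * ((c ^ 2 + 4) * cosh w ^ 2) := by gcongr; exact hcauchy.trans (by gcongr)
    _ = (c ^ 2 + 4) / 4 * (4 * (r * (1 - r)) * cosh w ^ 2) := by ring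
    _ = c ^ 2 / 4 + 1 := by rw [hcosh]; ring

lemma continuousOn_surprisalVar (d : ℕ) :
    ContinuousOn (surprisalVar (d := d)) (stdSimplex ℝ (Fin d)) := by
  have hcont : Continuous fun q : Fin d → ℝ =>
      ∑ i, 4 * (√(q i) * log √(q i)) ^ 2 - (∑ i, q i * log (q i)) ^ 2 := by
    have h := continuous_mul_log
    have h1 : ∀ i : Fin d, Continuous fun q : Fin d → ℝ => √(q i) * log √(q i) := fun i =>
      h.comp (continuous_sqrt.comp (continuous_apply i))
    have h2 : ∀ i : Fin d, Continuous fun q : Fin d → ℝ => q i * log (q i) := fun i =>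
      h.comp (continuous_apply i)
    fun_prop
  refine hcont.continuousOn.congr fun q hq => ?_
  simp only [surprisalVar]
  congr 1
  refine sum_congr rfl fun i _ => ?_
  rw [log_sqrt (hq.1 i), mul_pow, sq_sqrt (hq.1 i)]
  ring

/-- Stationarity of a maximizer of the surprisal variance under mass transfer between two points. -/
lemma eq_or_log_add_log_eq_of_isMaxOn {d : ℕ} {q : Fin d → ℝ} (hq : q ∈ stdSimplex ℝ (Fin d))
    (hmax : IsMaxOn surprisalVar (stdSimplex ℝ (Fin d)) q) {i j : Fin d}
    (hi : 0 < q i) (hj : 0 < q j) :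
    q i = q j ∨ log (q i) + log (q j) = 2 * (∑ k, q k * log (q k)) - 2 := by
  rcases eq_or_ne i j with rfl | hij
  · exact Or.inl rfl
  set c : Fin d → ℝ := fun k => (Pi.single j 1 : Fin d → ℝ) k - (Pi.single i 1 : Fin d → ℝ) k
    with hc
  have hci : c i = -1 := by simp [hc, hij]
  have hcj : c j = 1 := by simp [hc, hij.symm]
  have hck : ∀ k, k ≠ i → k ≠ j → c k = 0 := fun k h1 h2 => by simp [hc, h1, h2]
  have hsum : ∀ f : Fin d → ℝ, ∑ k, f k * c k = f j - f i := fun f => by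
    simp [hc, mul_sub, sum_sub_distrib, Pi.single_apply]
  have hline : ∀ k, HasDerivAt (fun t : ℝ => q k + t * c k) (c k) 0 := fun k => by
    simpa using ((hasDerivAt_id (0 : ℝ)).mul_const (c k)).const_add (q k)
  have hpos : ∀ k, c k ≠ 0 → q k ≠ 0 := fun k hk => by
    by_cases h1 : k = i
    · exact h1 ▸ hi.ne'
    by_cases h2 : k = j
    · exact h2 ▸ hj.ne'
    exact absurd (hck k h1 h2) hk
  have hd1 : ∀ k, HasDerivAt (fun t : ℝ => (q k + t * c k) * log (q k + t * c k))
      ((log (q k) + 1) * c k) 0 := fun k => by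
    by_cases hk : c k = 0
    · simpa [hk] using hasDerivAt_const (0 : ℝ) _
    · have h := hasDerivAt_mul_log (hpos k hk)
      refine HasDerivAt.comp (h₂ := fun x => x * log x) 0 ?_ (hline k)
      simpa using h
  have hd2 : ∀ k, HasDerivAt (fun t : ℝ => (q k + t * c k) * log (q k + t * c k) ^ 2)
      ((log (q k) ^ 2 + 2 * log (q k)) * c k) 0 := fun k => by
    by_cases hk : c k = 0
    · simpa [hk] using hasDerivAt_const (0 : ℝ) _
    · have hne := hpos k hk
      have h : HasDerivAt (fun x : ℝ => x * log x ^ 2) (log (q k) ^ 2 + 2 * log (q k)) (q k) := by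
        refine ((hasDerivAt_id (q k)).fun_mul ((hasDerivAt_log hne).fun_pow 2)).congr_deriv ?_
        simp only [id]
        field_simp
        norm_num
        ring
      refine HasDerivAt.comp (h₂ := fun x => x * log x ^ 2) 0 ?_ (hline k)
      simpa using h
  have hD := (HasDerivAt.fun_sum (u := univ) fun k _ => hd2 k).fun_sub
    ((HasDerivAt.fun_sum (u := univ) fun k _ => hd1 k).fun_pow 2)
  have hloc : IsLocalMax (fun t : ℝ => ∑ k, (q k + t * c k) * log (q k + t * c k) ^ 2
      - (∑ k, (q k + t * c k) * log (q k + t * c k)) ^ 2) 0 := by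
    have hnhds : Set.Ioo (-(q j)) (q i) ∈ nhds (0 : ℝ) := Ioo_mem_nhds (by linarith) hi
    filter_upwards [hnhds] with t ht
    have hmem : (fun k => q k + t * c k) ∈ stdSimplex ℝ (Fin d) := by
      refine ⟨fun k => ?_, ?_⟩
      · change 0 ≤ q k + t * c k
        by_cases h1 : k = i
        · subst h1; rw [hci]; linarith [ht.2]
        by_cases h2 : k = j
        · subst h2; rw [hcj]; linarith [ht.1]
        simpa [hck k h1 h2] using hq.1 k
      · rw [sum_add_distrib, hq.2, hsum fun _ => t]; ring
    simpa [surprisalVar] using hmax hmem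
  have hzero := hloc.hasDerivAt_eq_zero hD
  simp only [hsum, zero_mul, add_zero] at hzero
  norm_num at hzero
  have hfac : (log (q j) - log (q i)) *
      (log (q i) + log (q j) - (2 * (∑ k, q k * log (q k)) - 2)) = 0 := by
    linear_combination hzero
  rcases mul_eq_zero.1 hfac with h | h
  · exact Or.inl (log_injOn_pos hi hj (by linarith))
  · exact Or.inr (by linarith)

lemma log_div_sq_le {d m n : ℕ} (hm : 1 ≤ m) (hn : 1 ≤ n) (hmn : m + n ≤ d) :
    log ((m : ℝ) / n) ^ 2 ≤ log ((d : ℝ) - 1) ^ 2 := by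
  have hm' : (1 : ℝ) ≤ m := by exact_mod_cast hm
  have hn' : (1 : ℝ) ≤ n := by exact_mod_cast hn
  have hmn' : (m : ℝ) + n ≤ d := by exact_mod_cast hmn
  rw [log_div (by positivity) (by positivity)]
  have h1 := log_nonneg hm'
  have h2 := log_nonneg hn'
  have h3 : log (m : ℝ) ≤ log ((d : ℝ) - 1) := log_le_log (by positivity) (by linarith)
  have h4 : log (n : ℝ) ≤ log ((d : ℝ) - 1) := log_le_log (by positivity) (by linarith)
  exact sq_le_sq' (by linarith) (by linarith)

/-- A vector with at most two distinct nonzero entries satisfies the surprisal variance bound. -/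
lemma surprisalVar_le_of_two_levels {d : ℕ} {q : Fin d → ℝ} (hq : ∑ i, q i = 1)
    {i j : Fin d} (hi : 0 < q i) (hj : 0 < q j) (hij : q i ≠ q j)
    (hlev : ∀ k, q k = 0 ∨ q k = q i ∨ q k = q j) :
    surprisalVar q ≤ log ((d : ℝ) - 1) ^ 2 / 4 + 1 := by
  set α := q i with hα
  set β := q j with hβ
  set A := univ.filter fun k => q k = α with hA
  set B := univ.filter fun k => q k = β with hB
  have hsum : ∀ f : ℝ → ℝ, ∑ k, q k * f (q k) = #A * α * f α + #B * β * f β := fun f => by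
    have h : ∀ k, q k * f (q k)
        = (if q k = α then α * f α else 0) + (if q k = β then β * f β else 0) := fun k => by
      rcases hlev k with h | h | h
      · simp [h, hi.ne, hj.ne]
      · simp [h, hij]
      · simp [h, hij.symm]
    rw [sum_congr rfl fun k _ => h k, sum_add_distrib, ← sum_filter, ← sum_filter]
    simp only [sum_const, nsmul_eq_mul]
    ring
  have hAcard : 1 ≤ #A := card_pos.2 ⟨i, by simp [hA, hα]⟩
  have hBcard : 1 ≤ #B := card_pos.2 ⟨j, by simp [hB, hβ]⟩
  have hAB : #B + #A ≤ d := by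
    have hdisj : Disjoint B A := by
      rw [hA, hB, disjoint_filter]
      exact fun k _ h1 h2 => hij (h2.symm.trans h1)
    rw [← card_union_of_disjoint hdisj]
    simpa using card_le_univ (B ∪ A)
  have hA0 : (0 : ℝ) < #A := by exact_mod_cast hAcard
  have hB0 : (0 : ℝ) < #B := by exact_mod_cast hBcard
  have htot : #A * α + #B * β = 1 := by
    have := hsum fun _ => 1
    simpa [hq] using this.symm
  have hAα : 0 < #A * α := by positivity
  have hr : 0 < #B * β := by positivity
  have hodds : log α - log β
      = log ((#B : ℝ) / #A) + log ((1 - #B * β) / (#B * β)) := by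
    rw [show 1 - #B * β = #A * α by linarith, log_div hB0.ne' hA0.ne', log_div hAα.ne' hr.ne',
      log_mul hA0.ne' hi.ne', log_mul hB0.ne' hj.ne']
    ring
  have hvar : surprisalVar q = #B * β * (1 - #B * β) * (log α - log β) ^ 2 := by
    rw [surprisalVar, hsum fun x => log x ^ 2, hsum log, show #A * α = 1 - #B * β by linarith]
    ring
  rw [hvar, hodds]
  refine (mul_add_log_odds_sq_le hr (by linarith) _).trans ?_
  linarith [log_div_sq_le hBcard hAcard hAB]

/-- The surprisal variance of a probability vector on `d` points is at most
`(log (d - 1))² / 4 + 1`. -/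
theorem surprisalVar_le {d : ℕ} {q : Fin d → ℝ} (hq : q ∈ stdSimplex ℝ (Fin d)) :
    surprisalVar q ≤ log ((d : ℝ) - 1) ^ 2 / 4 + 1 := by
  obtain ⟨p, hp, hmax⟩ := (isCompact_stdSimplex ℝ (Fin d)).exists_isMaxOn ⟨q, hq⟩
    (continuousOn_surprisalVar d)
  refine (hmax hq).trans ?_
  obtain ⟨i, -, hi⟩ : ∃ i ∈ univ, 0 < p i :=
    exists_lt_of_sum_lt (by simp [hp.2] : ∑ _i : Fin d, (0 : ℝ) < ∑ i, p i)
  by_cases hall : ∀ j, 0 < p j → p j = p i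
  · have hsum : ∀ f : ℝ → ℝ, ∑ k, p k * f (p k) = f (p i) := fun f => by
      have h : ∀ k, p k * f (p k) = p k * f (p i) := fun k => by
        rcases (hp.1 k).eq_or_lt with h | h
        · simp [← h]
        · rw [hall k h]
      rw [sum_congr rfl fun k _ => h k, ← sum_mul, hp.2, one_mul]
    rw [surprisalVar, hsum fun x => log x ^ 2, hsum log, sub_self]
    positivity
  · push Not at hall
    obtain ⟨j, hj, hij⟩ := hall
    refine surprisalVar_le_of_two_levels hp.2 hi hj hij.symm fun k => ?_
    rcases (hp.1 k).eq_or_lt with h | hk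
    · exact Or.inl h.symm
    refine Or.inr ?_
    rcases eq_or_log_add_log_eq_of_isMaxOn hp hmax hi hk with h | h
    · exact Or.inl h.symm
    · rcases eq_or_log_add_log_eq_of_isMaxOn hp hmax hi hj with h' | h'
      · exact absurd h'.symm hij
      · exact Or.inr (log_injOn_pos hk hj (by linarith))

lemma sum_mul_log_sq_le {d : ℕ} {q v : Fin d → ℝ} (hq : q ∈ stdSimplex ℝ (Fin d))
    (hv : ∑ i, v i = 0) (hqv : ∀ i, q i = 0 → v i = 0) :
    (∑ i, v i * log (q i)) ^ 2 ≤ surprisalVar q * ∑ i, v i ^ 2 / q i := by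
  rw [surprisalVar_eq_sum_sq hq.2]
  set m := ∑ j, q j * log (q j)
  have hshift : ∑ i, v i * log (q i) = ∑ i, v i * (log (q i) - m) := by
    simp only [mul_sub, sum_sub_distrib, ← sum_mul, hv, zero_mul, sub_zero]
  rw [hshift]
  refine sum_sq_le_sum_mul_sum_of_sq_le_mul _ (fun i _ => mul_nonneg (hq.1 i) (sq_nonneg _))
    (fun i _ => div_nonneg (sq_nonneg _) (hq.1 i)) fun i _ => ?_
  rcases eq_or_ne (q i) 0 with h | h
  · simp [hqv i h]
  · apply le_of_eq
    field_simp

/-- On the segment between two probability vectors, `exp (H / N)` is concave as soon as `N` bounds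
the surprisal variance. -/
lemma concaveOn_exp_shEntropy_segment {d : ℕ} {p₀ p₁ : Fin d → ℝ} {N : ℝ} (hN : 0 < N)
    (hvar : ∀ q ∈ stdSimplex ℝ (Fin d), surprisalVar q ≤ N)
    (h₀ : p₀ ∈ stdSimplex ℝ (Fin d)) (h₁ : p₁ ∈ stdSimplex ℝ (Fin d)) :
    ConcaveOn ℝ (Set.Icc (0 : ℝ) 1)
      fun t => exp (shEntropy (fun i => p₀ i + t * (p₁ i - p₀ i)) / N) := by
  set v : Fin d → ℝ := fun i => p₁ i - p₀ i with hv
  have hv0 : ∑ i, v i = 0 := by simp [hv, sum_sub_distrib, h₀.2, h₁.2]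
  have hmem : ∀ t ∈ Set.Ioo (0 : ℝ) 1, (fun i => p₀ i + t * v i) ∈ stdSimplex ℝ (Fin d) := by
    intro t ht
    refine ⟨fun i => ?_, ?_⟩
    · have h1 := mul_nonneg (sub_pos.2 ht.2).le (h₀.1 i)
      have h2 := mul_nonneg ht.1.le (h₁.1 i)
      simp only [hv]
      linarith
    · rw [sum_add_distrib, ← mul_sum, hv0, h₀.2]; ring
  have hzero : ∀ t ∈ Set.Ioo (0 : ℝ) 1, ∀ i, p₀ i + t * v i = 0 → v i = 0 := by
    intro t ht i h
    have h1 := mul_nonneg (sub_pos.2 ht.2).le (h₀.1 i)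
    have h2 := mul_nonneg ht.1.le (h₁.1 i)
    simp only [hv] at h ⊢
    have h3 : (1 - t) * p₀ i = 0 := by linarith
    have h4 : t * p₁ i = 0 := by linarith
    have h5 := (mul_eq_zero.1 h3).resolve_left (sub_pos.2 ht.2).ne'
    have h6 := (mul_eq_zero.1 h4).resolve_left ht.1.ne'
    rw [h5, h6, sub_zero]
  have hline : ∀ i t, HasDerivAt (fun t : ℝ => p₀ i + t * v i) (v i) t := fun i t => by
    simpa using ((hasDerivAt_id t).mul_const (v i)).const_add (p₀ i)
  have hS : ∀ t ∈ Set.Ioo (0 : ℝ) 1, HasDerivAt (fun t => shEntropy fun i => p₀ i + t * v i)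
      (-∑ i, v i * log (p₀ i + t * v i)) t := by
    intro t ht
    have hterm : ∀ i, HasDerivAt (fun t => -((p₀ i + t * v i) * log (p₀ i + t * v i)))
        (-((log (p₀ i + t * v i) + 1) * v i)) t := fun i => by
      by_cases hi : p₀ i + t * v i = 0
      · simpa [hzero t ht i hi] using hasDerivAt_const t _
      · exact (HasDerivAt.comp (h₂ := fun x => x * log x) t
          (hasDerivAt_mul_log hi) (hline i t)).fun_neg
    refine (HasDerivAt.fun_sum (u := univ) fun i _ => hterm i).congr_deriv ?_
    simp only [mul_comm _ (v _), mul_add, mul_one, sum_add_distrib, sum_neg_distrib, hv0, add_zero]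
  have hS' : ∀ t ∈ Set.Ioo (0 : ℝ) 1,
      HasDerivAt (fun t => -∑ i, v i * log (p₀ i + t * v i))
      (-∑ i, v i ^ 2 / (p₀ i + t * v i)) t := by
    intro t ht
    refine (HasDerivAt.fun_sum fun i _ => ?_).fun_neg
    by_cases hi : p₀ i + t * v i = 0
    · simpa [hzero t ht i hi] using hasDerivAt_const t _
    · exact (((hline i t).log hi).const_mul (v i)).congr_deriv (by ring)
  have hE : ∀ t ∈ Set.Ioo (0 : ℝ) 1,
      HasDerivAt (fun t => exp (shEntropy (fun i => p₀ i + t * v i) / N))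
      (exp (shEntropy (fun i => p₀ i + t * v i) / N)
        * ((-∑ i, v i * log (p₀ i + t * v i)) / N)) t :=
    fun t ht => ((hS t ht).div_const N).exp
  refine concaveOn_of_hasDerivWithinAt2_nonpos (convex_Icc 0 1) ?_ (fun t ht => ?_)
    (fun t ht => ?_) (f' := fun t => exp (shEntropy (fun i => p₀ i + t * v i) / N)
        * ((-∑ i, v i * log (p₀ i + t * v i)) / N))
    (f'' := fun t => exp (shEntropy (fun i => p₀ i + t * v i) / N)
        * ((-∑ i, v i * log (p₀ i + t * v i)) / N) * ((-∑ i, v i * log (p₀ i + t * v i)) / N)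
        + exp (shEntropy (fun i => p₀ i + t * v i) / N)
          * ((-∑ i, v i ^ 2 / (p₀ i + t * v i)) / N)) (fun t ht => ?_)
  · have hcont : ∀ i, Continuous fun t : ℝ => (p₀ i + t * v i) * log (p₀ i + t * v i) :=
      fun i => continuous_mul_log.comp (by fun_prop)
    have : Continuous fun t : ℝ => shEntropy fun i => p₀ i + t * v i := by
      unfold shEntropy
      fun_prop
    exact (continuous_exp.comp (this.div_const N)).continuousOn
  · rw [interior_Icc] at ht
    exact (hE t ht).hasDerivWithinAt
  · rw [interior_Icc] at ht
    exact ((hE t ht).fun_mul ((hS' t ht).div_const N)).hasDerivWithinAt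
  · rw [interior_Icc] at ht
    have hq := hmem t ht
    have hJ : 0 ≤ ∑ i, v i ^ 2 / (p₀ i + t * v i) :=
      sum_nonneg fun i _ => div_nonneg (sq_nonneg _) (hq.1 i)
    have hcs : (∑ i, v i * log (p₀ i + t * v i)) ^ 2 ≤ N * ∑ i, v i ^ 2 / (p₀ i + t * v i) :=
      (sum_mul_log_sq_le hq hv0 (hzero t ht)).trans (mul_le_mul_of_nonneg_right (hvar _ hq) hJ)
    set D := ∑ i, v i * log (p₀ i + t * v i)
    set J := ∑ i, v i ^ 2 / (p₀ i + t * v i)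
    have hfac : exp (shEntropy (fun i => p₀ i + t * v i) / N) * (-D / N) * (-D / N)
        + exp (shEntropy (fun i => p₀ i + t * v i) / N) * (-J / N)
        = exp (shEntropy (fun i => p₀ i + t * v i) / N) * ((D ^ 2 - N * J) / N ^ 2) := by
      field_simp
      ring
    rw [hfac]
    exact mul_nonpos_of_nonneg_of_nonpos (exp_pos _).le
      (div_nonpos_of_nonpos_of_nonneg (by linarith) (by positivity))

lemma sub_sq_div_two_mul_cosh_le_sinh {x : ℝ} (hx : 0 ≤ x) :
    (x - x ^ 2 / 2) * cosh x ≤ sinh x := by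
  have hmono : MonotoneOn (fun x : ℝ => sinh x - (x - x ^ 2 / 2) * cosh x) (Set.Ici 0) := by
    refine monotoneOn_of_hasDerivWithinAt_nonneg (convex_Ici 0) (by fun_prop) (fun y _ => ?_)
      (f' := fun y => y * (cosh y - sinh y) + y ^ 2 / 2 * sinh y) (fun y hy => ?_)
    · have h : HasDerivAt (fun y : ℝ => y - y ^ 2 / 2) (1 - y) y := by
        refine ((hasDerivAt_id y).fun_sub ((hasDerivAt_pow 2 y).div_const 2)).congr_deriv ?_
        norm_num
      exact (((hasDerivAt_sinh y).fun_sub (h.fun_mul (hasDerivAt_cosh y))).congr_deriv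
        (by ring)).hasDerivWithinAt
    · rw [interior_Ici] at hy
      have hy' : (0 : ℝ) < y := hy
      have h1 := sinh_lt_cosh y
      have h2 := sinh_nonneg_iff.2 hy'.le
      have h3 : 0 ≤ cosh y - sinh y := by linarith
      positivity
  have := hmono (Set.self_mem_Ici) (Set.mem_Ici.2 hx) hx
  simp only [sinh_zero] at this
  norm_num at this
  linarith

lemma sq_div_two_sub_cube_div_six_le_log_cosh {x : ℝ} (hx : 0 ≤ x) :
    x ^ 2 / 2 - x ^ 3 / 6 ≤ log (cosh x) := by
  have hne : ∀ y : ℝ, cosh y ≠ 0 := fun y => (cosh_pos y).ne'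
  have hmono : MonotoneOn (fun x : ℝ => log (cosh x) - (x ^ 2 / 2 - x ^ 3 / 6)) (Set.Ici 0) := by
    have hder : ∀ y : ℝ, HasDerivAt (fun x : ℝ => log (cosh x) - (x ^ 2 / 2 - x ^ 3 / 6))
        (sinh y / cosh y - (y - y ^ 2 / 2)) y := fun y => by
      refine (((hasDerivAt_cosh y).log (hne y)).fun_sub (((hasDerivAt_pow 2 y).div_const 2).fun_sub
        ((hasDerivAt_pow 3 y).div_const 6))).congr_deriv ?_
      norm_num
      ring
    refine monotoneOn_of_hasDerivWithinAt_nonneg (convex_Ici 0)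
      (fun y _ => (hder y).continuousAt.continuousWithinAt)
      (fun y _ => (hder y).hasDerivWithinAt) (fun y hy => ?_)
    rw [interior_Ici] at hy
    rw [sub_nonneg, le_div_iff₀ (cosh_pos y)]
    exact sub_sq_div_two_mul_cosh_le_sinh (le_of_lt hy)
  have := hmono (Set.self_mem_Ici) (Set.mem_Ici.2 hx) hx
  simp only [cosh_zero, log_one] at this
  norm_num at this
  linarith

/-- The Jensen gap of the entropy at a midpoint is bounded below by the entropy difference. -/
lemma log_cosh_le_entropy_gap {d : ℕ} {p₀ p₁ : Fin d → ℝ} {N : ℝ} (hN : 0 < N)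
    (hvar : ∀ q ∈ stdSimplex ℝ (Fin d), surprisalVar q ≤ N)
    (h₀ : p₀ ∈ stdSimplex ℝ (Fin d)) (h₁ : p₁ ∈ stdSimplex ℝ (Fin d)) :
    N * log (cosh ((shEntropy p₁ - shEntropy p₀) / (2 * N)))
      ≤ shEntropy (fun i => (p₀ i + p₁ i) / 2) - (shEntropy p₀ + shEntropy p₁) / 2 := by
  have hmid := (concaveOn_exp_shEntropy_segment hN hvar h₀ h₁).2
    (Set.left_mem_Icc.2 zero_le_one) (Set.right_mem_Icc.2 zero_le_one)
    (by norm_num : (0 : ℝ) ≤ 1 / 2) (by norm_num : (0 : ℝ) ≤ 1 / 2) (by norm_num)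
  have hmix : (fun i => p₀ i + (1 / 2 : ℝ) * (p₁ i - p₀ i)) = fun i => (p₀ i + p₁ i) / 2 := by
    funext i; ring
  simp only [smul_eq_mul, mul_zero, zero_mul, add_zero, zero_add, mul_one, one_mul,
    add_sub_cancel, hmix] at hmid
  set S := shEntropy fun i => (p₀ i + p₁ i) / 2
  set a := shEntropy p₀
  set b := shEntropy p₁
  have hcosh : cosh ((b - a) / (2 * N)) ≤ exp ((S - (a + b) / 2) / N) := by
    have hsplit : exp ((S - (a + b) / 2) / N) = exp (S / N) * exp (-((a + b) / (2 * N))) := by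
      rw [← exp_add]; congr 1; field_simp; ring
    have e₀ : exp (-((b - a) / (2 * N))) = exp (a / N) * exp (-((a + b) / (2 * N))) := by
      rw [← exp_add]; congr 1; field_simp; ring
    have e₁ : exp ((b - a) / (2 * N)) = exp (b / N) * exp (-((a + b) / (2 * N))) := by
      rw [← exp_add]; congr 1; field_simp; ring
    rw [cosh_eq, e₀, e₁, hsplit]
    have := mul_le_mul_of_nonneg_right hmid (exp_pos (-((a + b) / (2 * N)))).le
    linarith
  have hlog := (log_le_iff_le_exp (cosh_pos _)).2 hcosh
  rw [le_div_iff₀ hN] at hlog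
  linarith

variable {X : Type*} [Fintype X] {d : ℕ} {W : X → Fin d → ℝ} {p : X → ℝ}

lemma mul_le_output (hW : ∀ x y, 0 ≤ W x y) (hp : ∀ x, 0 ≤ p x) (x : X) (y : Fin d) :
    p x * W x y ≤ ∑ x', p x' * W x' y :=
  single_le_sum (f := fun x' => p x' * W x' y) (fun x' _ => mul_nonneg (hp x') (hW x' y))
    (mem_univ x)

/-- Mutual information is the output entropy minus the mean conditional entropy. -/
lemma mutualInfo_eq (hW : ∀ x y, 0 ≤ W x y) (hp : ∀ x, 0 ≤ p x) :
    ∑ x, ∑ y, p x * W x y * log (W x y / ∑ x', p x' * W x' y)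
      = shEntropy (fun y => ∑ x, p x * W x y) - ∑ x, p x * shEntropy (W x) := by
  have hterm : ∀ x y, p x * W x y * log (W x y / ∑ x', p x' * W x' y)
      = p x * (W x y * log (W x y)) - p x * W x y * log (∑ x', p x' * W x' y) := fun x y => by
    rcases (mul_nonneg (hp x) (hW x y)).eq_or_lt with h | h
    · rw [← mul_assoc, ← h]; ring
    · rw [log_div (right_ne_zero_of_mul h.ne') (h.trans_le (mul_le_output hW hp x y)).ne']
      ring
  simp only [hterm, sum_sub_distrib]
  rw [sum_comm (f := fun x y => p x * W x y * log (∑ x', p x' * W x' y))]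
  simp only [shEntropy, ← sum_mul, ← mul_sum, sum_neg_distrib, mul_neg]
  ring

/-- Mutual information is bounded by the number of inputs. -/
lemma mutualInfo_le_card (hW : ∀ x y, 0 ≤ W x y) (hW1 : ∀ x, ∑ y, W x y = 1)
    (hp : ∀ x, 0 ≤ p x) :
    ∑ x, ∑ y, p x * W x y * log (W x y / ∑ x', p x' * W x' y) ≤ Fintype.card X := by
  have hterm : ∀ x y, p x * W x y * log (W x y / ∑ x', p x' * W x' y) ≤ W x y := fun x y => by
    have hu := mul_nonneg (hp x) (hW x y)
    have hle := mul_le_output hW hp x y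
    set q := ∑ x', p x' * W x' y
    have hq : 0 ≤ q := hu.trans hle
    calc p x * W x y * log (W x y / q) ≤ p x * W x y * (W x y / q) :=
          mul_le_mul_of_nonneg_left (log_le_self (div_nonneg (hW x y) hq)) hu
      _ = W x y * (p x * W x y / q) := by ring
      _ ≤ W x y := mul_le_of_le_one_right (hW x y) (div_le_one_of_le₀ hle hq)
  calc _ ≤ ∑ x, ∑ y, W x y := sum_le_sum fun x _ => sum_le_sum fun y _ => hterm x y
    _ = Fintype.card X := by simp [hW1]

end

/-- lower bound on the Shannon capacity of a discrete memoryless channel. -/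
theorem shannon_capacity_lower_bound {X : Type*} [Fintype X] [Nonempty X]
    (d : ℕ) (hd : 2 ≤ d) (W : X → Fin d → ℝ)
    (hW0 : ∀ x y, 0 ≤ W x y) (hW1 : ∀ x, ∑ y, W x y = 1)
    (Smax Smin : ℝ)
    (hmax : IsGreatest (Set.range fun x => shEntropy (W x)) Smax)
    (hmin : IsLeast (Set.range fun x => shEntropy (W x)) Smin) :
    sSup {c : ℝ | ∃ π : X → ℝ, (∀ x, 0 ≤ π x) ∧ ∑ x, π x = 1 ∧
        c = ∑ x, ∑ y, π x * W x y * Real.log (W x y / (∑ x', π x' * W x' y))} ≥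
      (Smax - Smin)^2 / (2 * ((Real.log ((d:ℝ) - 1))^2 + 4)) -
        (Smax - Smin)^3 / (3 * ((Real.log ((d:ℝ) - 1))^2 + 4)^2) := by
  classical
  obtain ⟨x₁, h₁⟩ := hmax.1
  obtain ⟨x₀, h₀⟩ := hmin.1
  have hΔ : 0 ≤ Smax - Smin := sub_nonneg.2 (hmin.2 hmax.1)
  set N := Real.log ((d : ℝ) - 1) ^ 2 / 4 + 1 with hN
  have hNpos : 0 < N := by positivity
  have hgap := log_cosh_le_entropy_gap hNpos (fun q hq => surprisalVar_le hq)
    ⟨hW0 x₀, hW1 x₀⟩ ⟨hW0 x₁, hW1 x₁⟩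
  simp only at h₀ h₁
  rw [h₀, h₁] at hgap
  have hlog := mul_le_mul_of_nonneg_left (sq_div_two_sub_cube_div_six_le_log_cosh
    (div_nonneg hΔ (by positivity : 0 ≤ 2 * N))) hNpos.le
  have hbound : (Smax - Smin) ^ 2 / (2 * (Real.log ((d : ℝ) - 1) ^ 2 + 4)) -
      (Smax - Smin) ^ 3 / (3 * (Real.log ((d : ℝ) - 1) ^ 2 + 4) ^ 2)
      = N * (((Smax - Smin) / (2 * N)) ^ 2 / 2 - ((Smax - Smin) / (2 * N)) ^ 3 / 6) := by
    rw [show Real.log ((d : ℝ) - 1) ^ 2 + 4 = 4 * N by rw [hN]; ring]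
    field_simp
    ring
  rw [ge_iff_le, hbound]
  refine (hlog.trans hgap).trans (le_csSup ⟨Fintype.card X, ?_⟩ ?_)
  · rintro c ⟨p, hp, -, rfl⟩
    exact mutualInfo_le_card hW0 hW1 hp
  · set p : X → ℝ := fun x =>
      ((Pi.single x₀ 1 : X → ℝ) x + (Pi.single x₁ 1 : X → ℝ) x) / 2 with hp
    have hp0 : ∀ x, 0 ≤ p x := fun x => by
      simp only [hp, Pi.single_apply]
      split_ifs <;> norm_num
    have hsum : ∀ f : X → ℝ, ∑ x, p x * f x = (f x₀ + f x₁) / 2 := fun f => by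
      simp only [hp, div_mul_eq_mul_div, add_mul, ← Finset.sum_div, Finset.sum_add_distrib,
        Pi.single_apply, ite_mul, one_mul, zero_mul, Finset.sum_ite_eq',
        Finset.mem_univ, if_true]
    refine ⟨p, hp0, ?_, ?_⟩
    · simpa using hsum fun _ => 1
    · rw [mutualInfo_eq hW0 hp0, hsum fun x => shEntropy (W x), h₀, h₁]
      simp only [hsum fun x => W x _]

end
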